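/- Let h>0, let n≥1 be an integer, set a := c−(n+1)h for a real number c (so that the points y_k = a+kh, k=0,…,n, satisfy y_n = c−h), and let g:[a,c−h]→ℝ be twice continuously differentiable. Let Π g denote the continuous piecewise linear interpolant of g with respect to the nodes y_0,…,y_n, i.e. (Π g)(y) = ((y−y_{k−1})/h)g(y_k) + ((y_k−y)/h)g(y_{k−1}) for y∈[y_{k−1},y_k]. Then |∫_a^{c−h} (g(y)−(Π g)(y)) (c−y)^{−1} dy| ≤ (‖g″‖_{L^∞([a,c−h])} h² / 2) · |ln h − ln(c−a)|. -/

import Mathlib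

open MeasureTheory

/-- A `C²` function whose second derivative is bounded below by `-M` becomes convex after adding
`M / 2 * x ^ 2`. -/
theorem convexOn_add_quadratic_of_neg_le_iteratedDerivWithin {u v M : ℝ} {g : ℝ → ℝ} (huv : u < v)
    (hg : ContDiffOn ℝ 2 g (Set.Icc u v))
    (hM : ∀ x ∈ Set.Icc u v, -M ≤ iteratedDerivWithin 2 g (Set.Icc u v) x) :
    ConvexOn ℝ (Set.Icc u v) (fun x => g x + M / 2 * x ^ 2) := by
  have hud := uniqueDiffOn_Icc huv
  have hg' : ContDiffOn ℝ 1 (derivWithin g (Set.Icc u v)) (Set.Icc u v) :=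
    hg.derivWithin hud (by norm_num)
  refine convexOn_of_hasDerivWithinAt2_nonneg (convex_Icc u v)
    (f' := fun x => derivWithin g (Set.Icc u v) x + M * x)
    (f'' := fun x => iteratedDerivWithin 2 g (Set.Icc u v) x + M)
    (hg.continuousOn.add (by fun_prop)) ?_ ?_ ?_
  · intro x hx
    have h₁ := ((hg.differentiableOn (by norm_num)) x (interior_subset hx)).hasDerivWithinAt.mono
      interior_subset
    have h₂ : HasDerivAt (fun x : ℝ => M / 2 * x ^ 2) (M * x) x := by
      refine ((hasDerivAt_pow 2 x).const_mul (M / 2)).congr_deriv ?_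
      push_cast
      ring
    exact h₁.add h₂.hasDerivWithinAt
  · intro x hx
    have h₁ := ((hg'.differentiableOn (by norm_num)) x (interior_subset hx)).hasDerivWithinAt.mono
      interior_subset
    have h₂ : HasDerivAt (fun x : ℝ => M * x) M x := by
      simpa using (hasDerivAt_id x).const_mul M
    have h₃ : iteratedDerivWithin 2 g (Set.Icc u v) x
        = derivWithin (derivWithin g (Set.Icc u v)) (Set.Icc u v) x := by
      rw [iteratedDerivWithin_succ, iteratedDerivWithin_one]
    rw [h₃]
    exact h₁.add h₂.hasDerivWithinAt
  · intro x hx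
    linarith [hM x (interior_subset hx)]

/-- One-sided error bound for linear interpolation at the nodes `p` and `p + h`. -/
theorem sub_linear_interpolant_le {u v M p h y : ℝ} {g : ℝ → ℝ} (huv : u < v)
    (hg : ContDiffOn ℝ 2 g (Set.Icc u v))
    (hM : ∀ x ∈ Set.Icc u v, -M ≤ iteratedDerivWithin 2 g (Set.Icc u v) x)
    (hh : 0 < h) (hp : p ∈ Set.Icc u v) (hq : p + h ∈ Set.Icc u v)
    (hy : y ∈ Set.Icc p (p + h)) :
    g y - ((y - p) / h * g (p + h) + (p + h - y) / h * g p)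
      ≤ M / 2 * ((y - p) * (p + h - y)) := by
  have hconv := (convexOn_add_quadratic_of_neg_le_iteratedDerivWithin huv hg hM).2 hq hp
    (div_nonneg (sub_nonneg.2 hy.1) hh.le) (div_nonneg (sub_nonneg.2 hy.2) hh.le)
    (by field_simp; ring)
  have hcomb : (y - p) / h * (p + h) + (p + h - y) / h * p = y := by
    field_simp
    ring
  simp only [smul_eq_mul, hcomb] at hconv
  have hquad : (y - p) / h * (M / 2 * (p + h) ^ 2) + (p + h - y) / h * (M / 2 * p ^ 2)
      - M / 2 * y ^ 2 = M / 2 * ((y - p) * (p + h - y)) := by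
    field_simp
    ring
  linarith

/-- Error bound for linear interpolation at the nodes `p` and `p + h`. -/
theorem abs_sub_linear_interpolant_le {u v M p h y : ℝ} {g : ℝ → ℝ} (huv : u < v)
    (hg : ContDiffOn ℝ 2 g (Set.Icc u v))
    (hM : ∀ x ∈ Set.Icc u v, |iteratedDerivWithin 2 g (Set.Icc u v) x| ≤ M)
    (hh : 0 < h) (hp : p ∈ Set.Icc u v) (hq : p + h ∈ Set.Icc u v)
    (hy : y ∈ Set.Icc p (p + h)) :
    |g y - ((y - p) / h * g (p + h) + (p + h - y) / h * g p)| ≤ M * h ^ 2 / 2 := by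
  have hM0 : 0 ≤ M := (abs_nonneg _).trans (hM p hp)
  have hprod : (y - p) * (p + h - y) ≤ h ^ 2 := by
    nlinarith [sq_nonneg (y - p - (p + h - y)), sq_nonneg h]
  have hquad : M / 2 * ((y - p) * (p + h - y)) ≤ M / 2 * h ^ 2 := by gcongr
  have h₁ := sub_linear_interpolant_le huv hg (fun x hx => (abs_le.1 (hM x hx)).1) hh hp hq hy
  have h₂ := sub_linear_interpolant_le (M := M) huv hg.neg (fun x hx => by
    have := (abs_le.1 (hM x hx)).2
    rw [iteratedDerivWithin_fun_neg]
    linarith) hh hp hq hy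
  rw [abs_le]
  constructor <;> linarith

/-- borderline (`β = 1`, `s = 1`) weighted piecewise-linear interpolation error
estimate: with grid `y_k = a + k h`, `a = c − (n+1)h`, `g ∈ C²([a, c−h])`, and `P = Πg` the
continuous piecewise linear interpolant of `g` on the nodes `y₀,…,y_n`,
`|∫_a^{c−h} (g − Πg)(y) (c−y)^{−1} dy| ≤ (‖g″‖_{L^∞} h²/2) |ln h − ln(c−a)|`. -/
theorem piecewise_interpolation_error_log (c h : ℝ) (n : ℕ) (hh : 0 < h) (hn : 1 ≤ n)
    (a : ℝ) (ha : a = c - (n + 1) * h)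
    (g P : ℝ → ℝ) (hg : ContDiffOn ℝ 2 g (Set.Icc a (c - h)))
    (hP : ∀ k : ℕ, 1 ≤ k → k ≤ n →
      ∀ y ∈ Set.Icc (a + ((k : ℝ) - 1) * h) (a + k * h),
        P y = ((y - (a + ((k : ℝ) - 1) * h)) / h) * g (a + k * h)
            + (((a + k * h) - y) / h) * g (a + ((k : ℝ) - 1) * h)) :
    |∫ y in a..(c - h), (g y - P y) * (c - y)⁻¹|
      ≤ (⨆ y : Set.Icc a (c - h), |iteratedDerivWithin 2 g (Set.Icc a (c - h)) y|)
          * h ^ 2 / 2 * |Real.log h - Real.log (c - a)| := by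
  have hn' : (1 : ℝ) ≤ n := by exact_mod_cast hn
  have hend : c - h = a + n * h := by rw [ha]; ring
  have hlt : a < c - h := by rw [hend]; nlinarith
  set M := ⨆ y : Set.Icc a (c - h), |iteratedDerivWithin 2 g (Set.Icc a (c - h)) y| with hMdef
  have hM : ∀ x ∈ Set.Icc a (c - h), |iteratedDerivWithin 2 g (Set.Icc a (c - h)) x| ≤ M := by
    intro x hx
    have hcont : ContinuousOn (fun x => |iteratedDerivWithin 2 g (Set.Icc a (c - h)) x|)
        (Set.Icc a (c - h)) :=
      (hg.continuousOn_iteratedDerivWithin le_rfl (uniqueDiffOn_Icc hlt)).abs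
    have hbdd := isCompact_Icc.bddAbove_image hcont
    rw [Set.image_eq_range] at hbdd
    exact le_ciSup hbdd ⟨x, hx⟩
  have herr : ∀ y ∈ Set.Ioc a (c - h), |g y - P y| ≤ M * h ^ 2 / 2 := by
    intro y hy
    have hpos : 0 < (y - a) / h := div_pos (sub_pos.2 hy.1) hh
    have hk1 : 1 ≤ ⌈(y - a) / h⌉₊ := Nat.ceil_pos.2 hpos
    have hkn : ⌈(y - a) / h⌉₊ ≤ n := by
      rw [Nat.ceil_le, div_le_iff₀ hh]
      linarith [hy.2]
    have hub := (div_le_iff₀ hh).1 (Nat.le_ceil ((y - a) / h))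
    have hlb := (lt_div_iff₀ hh).1 (sub_lt_iff_lt_add.2 (Nat.ceil_lt_add_one hpos.le))
    generalize ⌈(y - a) / h⌉₊ = k at hk1 hkn hub hlb
    have hk1' : (1 : ℝ) ≤ k := by exact_mod_cast hk1
    have hkn' : (k : ℝ) ≤ n := by exact_mod_cast hkn
    have hkh : (k : ℝ) * h ≤ n * h := by gcongr
    have hk0 : 0 ≤ ((k : ℝ) - 1) * h := mul_nonneg (by linarith) hh.le
    have hnode : a + (k : ℝ) * h = a + ((k : ℝ) - 1) * h + h := by ring
    rw [hP k hk1 hkn y ⟨by linarith, by linarith⟩, hnode]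
    exact abs_sub_linear_interpolant_le hlt hg hM hh ⟨by linarith, by linarith⟩
      ⟨by linarith, by linarith⟩ ⟨by linarith, by linarith⟩
  have hcy : ∀ y ∈ Set.uIcc a (c - h), c - y ≠ 0 := by
    intro y hy
    rw [Set.uIcc_of_le hlt.le] at hy
    linarith [hy.2]
  have hint : ∫ y in a..(c - h), (c - y)⁻¹ = |Real.log h - Real.log (c - a)| := by
    have hca : h < c - a := by linarith
    rw [intervalIntegral.integral_comp_sub_left (fun x => x⁻¹) c, sub_sub_cancel,
      integral_inv_of_pos hh (hh.trans hca), Real.log_div (hh.trans hca).ne' hh.ne', abs_sub_comm,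
      abs_of_nonneg (sub_nonneg.2 (Real.log_le_log hh hca.le))]
  rw [← hint, ← intervalIntegral.integral_const_mul, ← Real.norm_eq_abs]
  refine intervalIntegral.norm_integral_le_of_norm_le hlt.le (Filter.Eventually.of_forall ?_) ?_
  · intro y hy
    have hy0 : 0 ≤ (c - y)⁻¹ := inv_nonneg.2 (by linarith [hy.2])
    rw [norm_mul, Real.norm_eq_abs, Real.norm_of_nonneg hy0]
    exact mul_le_mul_of_nonneg_right (herr y hy) hy0
  · exact ((continuousOn_const.sub continuousOn_id).inv₀ hcy).intervalIntegrable.const_mul _
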